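/- Let F be a perfect field of characteristic p > 0 and let X ⊆ F((t))^{perf} be definable over F in the valued field language on the perfect hull F((t))^{perf}. If X ⊄ F, then the subfield of F((t))^{perf} generated by X is all of F((t))^{perf}. In particular, F((t))^{perf} has no infinite proper ∅-definable subfields containing an element outside F. -/

import Mathlib

open FirstOrder Language

variable (F : Type) [Field F] (p : ℕ) [Fact (Nat.Prime p)] [CharP F p]

instance : CharP (LaurentSeries F) p :=
  charP_of_injective_algebraMap (algebraMap F (LaurentSeries F)).injective p

/-- The perfect hull `F((t))^perf` of `F((t))`. -/
abbrev PerfLaurent := PerfectClosure (LaurentSeries F) p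

noncomputable instance : Algebra F (PerfLaurent F p) :=
  ((PerfectClosure.of (LaurentSeries F) p).comp (algebraMap F (LaurentSeries F))).toAlgebra

/-- A language with a single unary relation symbol `O` (the valuation ring predicate). -/
def valLang : FirstOrder.Language :=
  ⟨fun _ => Empty, fun n => match n with | 1 => PUnit | _ => Empty⟩

/-- Interpret `O` on `F((t))^perf` as the valuation ring of the unique extension of the
`t`-adic valuation: those `x` with `x^{p^m}` in (the image of) `F[[t]]` for some `m`. -/
instance valLangStructurePerf : valLang.Structure (PerfLaurent F p) where
  funMap := fun {_} f _ => f.elim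
  RelMap := fun {n} r x =>
    match n, r with
    | 1, _ => ∃ (m : ℕ) (g : PowerSeries F),
        PerfectClosure.of (LaurentSeries F) p (g : LaurentSeries F) = (x 0) ^ p ^ m
    | 0, r => r.elim
    | (_ + 2), r => r.elim

noncomputable instance : Language.ring.Structure (PerfLaurent F p) :=
  (FirstOrder.Ring.compatibleRingOfRing (PerfLaurent F p)).toStructure

noncomputable instance : (constantsOn F).Structure (PerfLaurent F p) :=
  constantsOn.structure (algebraMap F (PerfLaurent F p))

/-- The language `L_vf(F)` of valued fields with constants for `F`. -/
abbrev Lvf : FirstOrder.Language := (Language.ring.sum valLang).withConstants F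

section PS
open PowerSeries
variable {K : Type} [Field K]

theorem ps_fixed (Φ : PowerSeries K → PowerSeries K)
    (hΦ : ∀ (n : ℕ) (a b : PowerSeries K), X ^ n ∣ a - b → X ^ (n + 1) ∣ Φ a - Φ b) :
    ∃ k, Φ k = k := by
  have h1 : ∀ n, X ^ n ∣ Φ^[n + 1] 0 - Φ^[n] 0 := by
    intro n
    induction n with
    | zero => simp
    | succ n ih =>
      rw [Function.iterate_succ_apply' Φ (n + 1), Function.iterate_succ_apply' Φ n]
      exact hΦ n _ _ (by rw [← Function.iterate_succ_apply' Φ n]; exact ih)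
  have h2 : ∀ n m, X ^ n ∣ Φ^[n + m] 0 - Φ^[n] 0 := by
    intro n m
    induction m with
    | zero => simp
    | succ m ih =>
      have := dvd_add ((pow_dvd_pow X (Nat.le_add_right n m)).trans (h1 (n + m))) ih
      simpa [add_assoc] using this
  let k : PowerSeries K := PowerSeries.mk fun n => coeff n (Φ^[n + 1] 0)
  have h3 : ∀ n, X ^ n ∣ Φ^[n] 0 - k := by
    intro n
    rw [X_pow_dvd_iff]
    intro m hm
    have := h2 (m + 1) (n - (m + 1))
    rw [X_pow_dvd_iff] at this
    have := this m (Nat.lt_succ_self m)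
    rw [Nat.add_sub_cancel' hm] at this
    simpa [k] using this
  refine ⟨k, ?_⟩
  have h4 : ∀ n, X ^ n ∣ Φ k - k := by
    intro n
    have e1 := hΦ n _ _ (h3 n)
    rw [← Function.iterate_succ_apply' Φ n] at e1
    have := dvd_sub (h3 (n + 1)) e1
    refine (pow_dvd_pow X (Nat.le_succ n)).trans ?_
    simpa using this
  rw [← sub_eq_zero]
  ext n
  exact (X_pow_dvd_iff.1 (h4 (n + 1))) n (Nat.lt_succ_self n)

theorem ps_poly_taylor (P : Polynomial K) (a b δ : PowerSeries K)
    (ha : δ ∣ a - X) (hb : δ ∣ b - X) :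
    (a - b) * δ ∣ Polynomial.aeval a P - Polynomial.aeval b P
      - (a - b) * (d⁄dX K (P : PowerSeries K)) := by
  have hX : ∀ Q : Polynomial K, (Q : PowerSeries K) = Polynomial.aeval (X : PowerSeries K) Q := by
    intro Q
    induction Q using Polynomial.induction_on' with
    | add p q hp hq => simp [hp, hq]
    | monomial n c =>
      rw [Polynomial.aeval_monomial, Polynomial.coe_monomial]
      change _ = C c * X ^ n
      ext m
      simp [coeff_X_pow, coeff_monomial]
  rw [derivative_coe, hX]
  set Q := P.map (algebraMap K (PowerSeries K)) with hQ
  have e : ∀ c : PowerSeries K, Polynomial.aeval c P = Q.eval c := by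
    intro c; rw [hQ, Polynomial.eval_map_algebraMap]
  have e' : Polynomial.aeval (X : PowerSeries K) P.derivative = Q.derivative.eval X := by
    rw [hQ, Polynomial.derivative_map, Polynomial.eval_map_algebraMap]
  rw [e, e, e']
  obtain ⟨k, hk⟩ := Polynomial.binomExpansion Q b (a - b)
  rw [add_sub_cancel] at hk
  obtain ⟨c, hc⟩ := hb.trans (Polynomial.sub_dvd_eval_sub b X Q.derivative)
  obtain ⟨d, hd⟩ : δ ∣ a - b := by simpa using dvd_sub ha hb
  refine ⟨c + k * d, ?_⟩
  rw [hk]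
  linear_combination (a - b) * hc + k * (a - b) * hd

theorem ps_taylor (f a b δ : PowerSeries K) (hδ : δ ≠ 0)
    (ha0 : X ∣ a) (hb0 : X ∣ b)
    (ha : δ ∣ a - X) (hb : δ ∣ b - X) :
    (a - b) * δ ∣ subst a f - subst b f - (a - b) * (d⁄dX K f) := by
  by_cases hab : a = b
  · simp [hab]
  have hD : (a - b) * δ ≠ 0 := mul_ne_zero (sub_ne_zero.2 hab) hδ
  have hsa : HasSubst a := HasSubst.of_constantCoeff_zero' (X_dvd_iff.1 ha0)
  have hsb : HasSubst b := HasSubst.of_constantCoeff_zero' (X_dvd_iff.1 hb0)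
  obtain ⟨M, hM⟩ : ∃ M, (a - b) * δ ∣ X ^ M := by
    refine ⟨((a - b) * δ).order.toNat, ?_⟩
    refine ⟨Inv_divided_by_X_pow_order hD, ?_⟩
    have h1 := X_pow_order_mul_divXPowOrder (f := (a - b) * δ)
    have h2 := Inv_divided_by_X_pow_order_rightInv hD
    linear_combination Inv_divided_by_X_pow_order hD * h1 - X ^ ((a - b) * δ).order.toNat * h2
  have hf := f.eq_X_pow_mul_shift_add_trunc (M + 1)
  set g : PowerSeries K := PowerSeries.mk fun i => coeff (i + (M + 1)) f
  set P := trunc (M + 1) f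
  have key := ps_poly_taylor P a b δ ha hb
  have e1 : ∀ c : PowerSeries K, HasSubst c → subst c f = c ^ (M + 1) * subst c g + Polynomial.aeval c P := by
    intro c hc
    rw [hf, subst_add hc, subst_mul hc, subst_pow hc, subst_X hc, subst_coe hc]
  have d1 : X ^ M ∣ d⁄dX K f - d⁄dX K (P : PowerSeries K) := by
    rw [hf, map_add, add_sub_cancel_right, Derivation.leibniz, derivative_pow]
    refine dvd_add (dvd_mul_of_dvd_left (pow_dvd_pow _ (Nat.le_succ M)) _) ?_
    simp only [smul_eq_mul]
    refine dvd_mul_of_dvd_right ?_ _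
    refine ⟨(M + 1 : ℕ) * d⁄dX K X, ?_⟩
    simp
    try ring
  have h2 : ∀ c : PowerSeries K, X ∣ c → (a - b) * δ ∣ c ^ (M + 1) := by
    intro c hc
    exact hM.trans ((pow_dvd_pow_of_dvd hc M).trans (pow_dvd_pow _ (Nat.le_succ M)))
  have h3 := dvd_add (dvd_add key (dvd_sub (dvd_mul_of_dvd_left (h2 a ha0) (subst a g))
    (dvd_mul_of_dvd_left (h2 b hb0) (subst b g)))) (dvd_neg.2 (dvd_mul_of_dvd_right (hM.trans d1) (a - b)))
  convert h3 using 1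
  rw [e1 a hsa, e1 b hsb]
  ring

theorem ps_solve (f w : PowerSeries K) (hf : d⁄dX K f ≠ 0) :
    ∃ k : PowerSeries K, subst (X + (d⁄dX K f * X ^ 2) * k) f
      = f + (d⁄dX K f * X ^ 2) * d⁄dX K f * w := by
  set d := d⁄dX K f with hd
  set δ := d * X ^ 2 with hδ
  have hδ0 : δ ≠ 0 := mul_ne_zero hf (pow_ne_zero _ X_ne_zero)
  have hX2 : (X : PowerSeries K) ∣ δ := ⟨d * X, by rw [hδ]; ring⟩
  have T : ∀ k k' : PowerSeries K, ∃ c, subst (X + δ * k) f - subst (X + δ * k') f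
      = δ * d * ((k - k') * (1 + X ^ 2 * c)) := by
    intro k k'
    obtain ⟨c, hc⟩ := ps_taylor f (X + δ * k) (X + δ * k') δ hδ0
      (dvd_add dvd_rfl (dvd_mul_of_dvd_left hX2 _)) (dvd_add dvd_rfl (dvd_mul_of_dvd_left hX2 _))
      (by simp) (by simp)
    refine ⟨c, ?_⟩
    rw [sub_eq_iff_eq_add] at hc
    rw [hc, ← hd, hδ]
    ring
  have T0 : ∀ k : PowerSeries K, ∃ e, subst (X + δ * k) f - f = δ * d * e := by
    intro k
    obtain ⟨c, hc⟩ := T k 0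
    rw [mul_zero, add_zero, X_subst] at hc
    exact ⟨_, hc⟩
  choose Ψ hΨ using T0
  obtain ⟨k, hk⟩ := ps_fixed (fun k => k - Ψ k + w) (by
    intro n a b hab
    obtain ⟨c, hc⟩ := T a b
    have h1 : δ * d * (Ψ a - Ψ b) = δ * d * ((a - b) * (1 + X ^ 2 * c)) := by
      rw [← hc, mul_sub, ← hΨ, ← hΨ]; ring
    have h2 := mul_left_cancel₀ (mul_ne_zero hδ0 hf) h1
    obtain ⟨e, he⟩ := hab
    refine ⟨- (e * X * c), ?_⟩
    have : a - Ψ a + w - (b - Ψ b + w) = (a - b) - (Ψ a - Ψ b) := by ring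
    rw [this, h2, he]
    ring)
  refine ⟨k, ?_⟩
  have : Ψ k = w := by
    have : k - Ψ k + w - k = 0 := by rw [sub_eq_zero]; exact hk
    linear_combination -this
  rw [← this, ← hΨ k]
  ring

theorem ps_aut (e : PowerSeries K) : ∃ σ : PowerSeries K ≃+* PowerSeries K,
    (∀ c, σ (C c) = C c) ∧ ∀ f, σ f = subst (X + X ^ 2 * e) f := by
  set s : PowerSeries K := X + X ^ 2 * e with hs
  have hs0 : constantCoeff s = 0 := by simp [hs]
  have hs1 : IsUnit (coeff 1 s) := by
    have : coeff 1 s = 1 := by simp [hs, coeff_X_pow_mul']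
    rw [this]; exact isUnit_one
  have ha : HasSubst s := HasSubst.of_constantCoeff_zero' hs0
  have hb : HasSubst (s.substInvOfIsUnit hs1) := HasSubst.substInvOfIsUnit _ _
  have bij : Function.Bijective (substAlgHom (R := K) ha) := by
    rw [Function.bijective_iff_has_inverse]
    refine ⟨subst (s.substInvOfIsUnit hs1), fun f => ?_, fun f => ?_⟩
    · rw [coe_substAlgHom, subst_comp_subst_apply ha hb, subst_substInvOfIsUnit_right _ hs0, X_subst]
    · rw [coe_substAlgHom, subst_comp_subst_apply hb ha, subst_substInvOfIsUnit_left _ hs0, X_subst]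
  refine ⟨RingEquiv.ofBijective (substAlgHom (R := K) ha) bij, fun c => ?_, fun f => ?_⟩
  · exact (substAlgHom (R := K) ha).commutes c
  · simp [coe_substAlgHom]

theorem ps_frob (p : ℕ) [Fact p.Prime] [CharP K p] (f : PowerSeries K) (hf : d⁄dX K f = 0) :
    ∃ g : PowerSeries K, g ^ p = PowerSeries.map (frobenius K p) f ∧
      ∀ n, coeff n g = coeff (p * n) f := by
  have hp : p ≠ 0 := (Fact.out : p.Prime).ne_zero
  refine ⟨PowerSeries.mk fun n => coeff (p * n) f, ?_, fun n => by simp⟩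
  set g := PowerSeries.mk fun n => coeff (p * n) f
  have : g ^ p = PowerSeries.map (frobenius K p) (expand p hp g) :=
    (MvPowerSeries.map_frobenius_expand p hp).symm
  rw [this]
  congr 1
  ext n
  rw [coeff_expand]
  split_ifs with h
  · simp [g, Nat.mul_div_cancel' h]
  · cases n with
    | zero => simp at h
    | succ n =>
      have := congrArg (coeff n) hf
      rw [coeff_derivative] at this
      simp only [map_zero, mul_eq_zero] at this
      rcases this with h' | h'
      · exact h'.symm
      · exfalso
        apply h
        rw [← CharP.cast_eq_zero_iff K p]
        exact_mod_cast h'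
end PS

section Perf
variable {F p}

/-- the valuation ring predicate -/
def Oval (x : PerfLaurent F p) : Prop := ∃ (m : ℕ) (g : PowerSeries F),
  PerfectClosure.of (LaurentSeries F) p (g : LaurentSeries F) = x ^ p ^ m

/-- automorphisms over `F` preserving the valuation ring -/
def GoodAut (τ : PerfLaurent F p ≃+* PerfLaurent F p) : Prop :=
  (∀ c : F, τ (algebraMap F (PerfLaurent F p) c) = algebraMap F (PerfLaurent F p) c) ∧
  ∀ x, Oval (τ x) ↔ Oval x

theorem algMap_eq (c : F) : algebraMap F (PerfLaurent F p) c =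
    PerfectClosure.of (LaurentSeries F) p ((PowerSeries.C c : PowerSeries F) : LaurentSeries F) := by
  change PerfectClosure.of (LaurentSeries F) p (algebraMap F (LaurentSeries F) c) = _
  rw [HahnSeries.ofPowerSeries_C, LaurentSeries.algebraMap_apply]

theorem goodAut_realize (τ : PerfLaurent F p ≃+* PerfLaurent F p) (hτ : GoodAut τ)
    (φ : (Lvf F).Formula (Fin 1)) (x : PerfLaurent F p) (hx : φ.Realize (fun _ => x)) :
    φ.Realize (fun _ => τ x) := by
  let g : (Lvf F).Equiv (PerfLaurent F p) (PerfLaurent F p) :=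
    { toEquiv := τ.toEquiv
      map_fun' := by
        intro n f v
        rcases f with (f | f) | f
        · cases f
          · exact map_add τ (v 0) (v 1)
          · exact map_mul τ (v 0) (v 1)
          · exact map_neg τ (v 0)
          · exact map_zero τ
          · exact map_one τ
        · exact f.elim
        · cases n with
          | zero => exact hτ.1 f
          | succ n => exact f.elim
      map_rel' := by
        intro n r v
        rcases r with (r | r) | r
        · exact r.elim
        · match n, r with
          | 1, _ => exact hτ.2 (v 0)
          | 0, r => exact r.elim
          | (_ + 2), r => exact r.elim
        · exact r.elim }
  exact (StrongHomClass.realize_formula g φ (v := fun _ => x)).2 hx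

theorem perf_pow (x : PerfLaurent F p) : ∃ (n : ℕ) (l : LaurentSeries F),
    x ^ p ^ n = PerfectClosure.of (LaurentSeries F) p l := by
  obtain ⟨⟨n, l⟩, rfl⟩ := PerfectClosure.mk_surjective (LaurentSeries F) p x
  refine ⟨n, l, ?_⟩
  rw [← PerfectClosure.iterate_frobenius_mk, iterate_frobenius]

theorem pow_inj (n : ℕ) {x y : PerfLaurent F p} (h : x ^ p ^ n = y ^ p ^ n) : x = y := by
  apply (frobenius_inj (PerfLaurent F p) p).iterate n
  simpa [iterate_frobenius] using h

theorem lift_aut (e : PowerSeries F ≃+* PowerSeries F) :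
    ∃ (τ : PerfLaurent F p ≃+* PerfLaurent F p) (ε : LaurentSeries F ≃+* LaurentSeries F),
      (∀ l, τ (PerfectClosure.of (LaurentSeries F) p l) =
        PerfectClosure.of (LaurentSeries F) p (ε l)) ∧
      ∀ g : PowerSeries F, ε (g : LaurentSeries F) = ((e g : PowerSeries F) : LaurentSeries F) := by
  let ε : LaurentSeries F ≃+* LaurentSeries F := IsFractionRing.ringEquivOfRingEquiv e
  let A := PerfectClosure.of (LaurentSeries F) p
  let L := PerfectClosure.lift (LaurentSeries F) p (PerfLaurent F p)
  have hL : ∀ (j : LaurentSeries F →+* PerfLaurent F p) l, L j (A l) = j l := fun j l => by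
    have := L.symm_apply_apply j
    exact congrArg (fun q => q l) this
  let τ₁ := L (A.comp ε.toRingHom)
  let τ₂ := L (A.comp ε.symm.toRingHom)
  have h12 : ∀ (u v : LaurentSeries F ≃+* LaurentSeries F), (∀ l, u (v l) = l) →
      ∀ x, L (A.comp u.toRingHom) (L (A.comp v.toRingHom) x) = x := by
    intro u v huv x
    obtain ⟨n, l, hl⟩ := perf_pow x
    apply pow_inj n
    rw [← map_pow, ← map_pow, hl]
    change L (A.comp u.toRingHom) (L (A.comp v.toRingHom) (A l)) = A l
    rw [hL]
    change L (A.comp u.toRingHom) (A (v l)) = A l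
    rw [hL]
    change A (u (v l)) = A l
    rw [huv]
  refine ⟨RingEquiv.ofRingHom τ₁ τ₂ ?_ ?_, ε, ?_, ?_⟩
  · ext x; exact h12 ε ε.symm (by simp) x
  · ext x; exact h12 ε.symm ε (by simp) x
  · intro l; exact hL (A.comp ε.toRingHom) l
  · intro g; exact IsFractionRing.ringEquivOfRingEquiv_algebraMap e g

theorem oval_map (e : PowerSeries F ≃+* PowerSeries F) (τ : PerfLaurent F p ≃+* PerfLaurent F p)
    (h : ∀ g : PowerSeries F, τ (PerfectClosure.of (LaurentSeries F) p (g : LaurentSeries F)) =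
      PerfectClosure.of (LaurentSeries F) p ((e g : PowerSeries F) : LaurentSeries F)) (x) :
    Oval (τ x) ↔ Oval x := by
  constructor
  · rintro ⟨m, g, hg⟩
    refine ⟨m, e.symm g, τ.injective ?_⟩
    rw [h, map_pow, e.apply_symm_apply, hg]
  · rintro ⟨m, g, hg⟩
    refine ⟨m, e g, ?_⟩
    rw [← h, hg, map_pow]

theorem oval_pow (x : PerfLaurent F p) : Oval (x ^ p) ↔ Oval x := by
  constructor
  · rintro ⟨m, g, hg⟩
    exact ⟨m + 1, g, by rw [hg, ← pow_mul, pow_succ']⟩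
  · rintro ⟨m, g, hg⟩
    refine ⟨m, g ^ p, ?_⟩
    rw [PowerSeries.coe_pow, map_pow, hg, ← pow_mul, ← pow_mul, mul_comm]

/-- The Frobenius twist `t ↦ t^{1/p}`. -/
theorem exists_twist [PerfectRing F p] :
    ∃ (T : PerfLaurent F p ≃+* PerfLaurent F p) (ε : LaurentSeries F ≃+* LaurentSeries F),
      GoodAut T ∧ GoodAut T.symm ∧
      (∀ l, T (PerfectClosure.of (LaurentSeries F) p l) ^ p =
        PerfectClosure.of (LaurentSeries F) p (ε l)) ∧
      ∀ g : PowerSeries F, ε (g : LaurentSeries F) =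
        ((PowerSeries.map (frobenius F p) g : PowerSeries F) : LaurentSeries F) := by
  let e : PowerSeries F ≃+* PowerSeries F :=
    RingEquiv.ofBijective (PowerSeries.map (frobenius F p)) (by
      constructor
      · intro f g hfg
        ext n
        have := congrArg (PowerSeries.coeff n) hfg
        simp only [PowerSeries.coeff_map] at this
        exact frobenius_inj F p this
      · intro f
        refine ⟨PowerSeries.map (frobeniusEquiv F p).symm.toRingHom f, ?_⟩
        ext n
        simp)
  obtain ⟨τ, ε, h1, h2⟩ := lift_aut (p := p) e
  let T : PerfLaurent F p ≃+* PerfLaurent F p := τ.trans (frobeniusEquiv (PerfLaurent F p) p).symm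
  have hT : ∀ x, T x ^ p = τ x := fun x => by
    have := frobenius_apply_frobeniusEquiv_symm (PerfLaurent F p) p (τ x)
    rwa [frobenius_def] at this
  have good : GoodAut T := by
    constructor
    · intro c
      apply frobenius_inj (PerfLaurent F p) p
      rw [frobenius_def, frobenius_def, hT, algMap_eq, h1, h2, ← map_pow, ← PowerSeries.coe_pow]
      congr 2
      change PowerSeries.map (frobenius F p) (PowerSeries.C c) = _
      rw [PowerSeries.map_C, frobenius_def, map_pow]
    · intro x
      rw [← oval_pow, hT]
      exact oval_map e τ (fun g => by rw [h1, h2]) x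
  refine ⟨T, ε, good, ⟨fun c => ?_, fun x => ?_⟩, fun l => by rw [hT, h1], h2⟩
  · rw [RingEquiv.symm_apply_eq, good.1]
  · rw [← good.2, T.apply_symm_apply]

theorem main_gen [PerfectRing F p] (X : Set (PerfLaurent F p))
    (hinv : ∀ τ : PerfLaurent F p ≃+* PerfLaurent F p, GoodAut τ → ∀ x ∈ X, τ x ∈ X)
    (f : PowerSeries F)
    (hfX : PerfectClosure.of (LaurentSeries F) p (f : LaurentSeries F) ∈ X)
    (hf : PowerSeries.derivative F f ≠ 0) :
    ∀ l, PerfectClosure.of (LaurentSeries F) p l ∈ Subfield.closure X := by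
  set A := PerfectClosure.of (LaurentSeries F) p with hA
  set d := PowerSeries.derivative F f with hd
  have hB : ∀ w : PowerSeries F, A ((d * PowerSeries.X ^ 2 * d * w : PowerSeries F) : LaurentSeries F)
      ∈ Subfield.closure X := by
    intro w
    obtain ⟨k, hk⟩ := ps_solve f w hf
    obtain ⟨σ, hσ1, hσ2⟩ := ps_aut (d * k)
    obtain ⟨τ, ε, h1, h2⟩ := lift_aut (p := p) σ
    have good : GoodAut τ := ⟨fun c => by rw [algMap_eq, h1, h2, hσ1],
      oval_map σ τ (fun g => by rw [h1, h2])⟩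
    have m := hinv τ good _ hfX
    rw [hA, h1, h2, hσ2, show PowerSeries.X + PowerSeries.X ^ 2 * (d * k) =
      PowerSeries.X + (d * PowerSeries.X ^ 2) * k by ring, hk, ← hA] at m
    have := (Subfield.closure X).sub_mem (Subfield.subset_closure m) (Subfield.subset_closure hfX)
    simpa [← map_sub, ← PowerSeries.coe_sub] using this
  have hne : d * PowerSeries.X ^ 2 * d ≠ 0 :=
    mul_ne_zero (mul_ne_zero hf (pow_ne_zero _ PowerSeries.X_ne_zero)) hf
  intro l
  obtain ⟨a, b, hb, rfl⟩ := IsFractionRing.div_surjective (A := PowerSeries F) l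
  have hb0 : b ≠ 0 := nonZeroDivisors.ne_zero hb
  have := (Subfield.closure X).div_mem (hB a) (hB b)
  convert this using 1
  set D := d * PowerSeries.X ^ 2 * d
  rw [← map_div₀ A]
  congr 1
  change algebraMap (PowerSeries F) (LaurentSeries F) a / algebraMap (PowerSeries F) (LaurentSeries F) b =
    algebraMap (PowerSeries F) (LaurentSeries F) (D * a) / algebraMap (PowerSeries F) (LaurentSeries F) (D * b)
  clear_value D
  rw [map_mul, map_mul, mul_div_mul_left]
  exact fun h => hne ((IsFractionRing.injective (PowerSeries F) (LaurentSeries F)) (by simpa using h))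

theorem main_descent [PerfectRing F p] (X : Set (PerfLaurent F p))
    (hinv : ∀ τ : PerfLaurent F p ≃+* PerfLaurent F p, GoodAut τ → ∀ x ∈ X, τ x ∈ X)
    (n : ℕ) : ∀ (f : PowerSeries F), n ≠ 0 → PowerSeries.coeff n f ≠ 0 →
    PerfectClosure.of (LaurentSeries F) p (f : LaurentSeries F) ∈ X →
    ∀ l, PerfectClosure.of (LaurentSeries F) p l ∈ Subfield.closure X := by
  induction n using Nat.strong_induction_on with
  | _ n ih =>
    intro f hn hc hfX
    by_cases hf : PowerSeries.derivative F f = 0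
    swap
    · exact main_gen X hinv f hfX hf
    obtain ⟨g, hg1, hg2⟩ := ps_frob p f hf
    obtain ⟨T, ε, good, -, h1, h2⟩ := exists_twist (F := F) (p := p)
    have hp : p.Prime := Fact.out
    have hpn : p ∣ n := by
      by_contra h
      obtain ⟨m, rfl⟩ := Nat.exists_eq_succ_of_ne_zero hn
      have := congrArg (PowerSeries.coeff m) hf
      rw [PowerSeries.coeff_derivative] at this
      simp only [map_zero, mul_eq_zero] at this
      rcases this with h' | h'
      · exact hc h'
      · apply h
        rw [← CharP.cast_eq_zero_iff F p]
        exact_mod_cast h'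
    obtain ⟨m, rfl⟩ := hpn
    have hm : m ≠ 0 := by rintro rfl; simp at hn
    refine ih m (lt_mul_of_one_lt_left (Nat.pos_of_ne_zero hm) hp.one_lt) g hm (by rwa [hg2]) ?_
    have := hinv T good _ hfX
    convert this using 1
    apply frobenius_inj (PerfLaurent F p) p
    rw [frobenius_def, frobenius_def, h1, h2, ← hg1, PowerSeries.coe_pow, map_pow]

theorem main_closure [PerfectRing F p] (X : Set (PerfLaurent F p))
    (hinv : ∀ τ : PerfLaurent F p ≃+* PerfLaurent F p, GoodAut τ → ∀ x ∈ X, τ x ∈ X)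
    (hX : ¬ X ⊆ Set.range (algebraMap F (PerfLaurent F p))) :
    Subfield.closure X = ⊤ := by
  obtain ⟨T, ε, good, good', h1, h2⟩ := exists_twist (F := F) (p := p)
  have hT : ∀ n x l, x ^ p ^ n = PerfectClosure.of (LaurentSeries F) p l →
      ∃ l', x = T^[n] (PerfectClosure.of (LaurentSeries F) p l') := by
    intro n
    induction n with
    | zero => intro x l h; exact ⟨l, by simpa using h⟩
    | succ n ih =>
      intro x l h
      obtain ⟨l', hl'⟩ := ih (x ^ p) l (by rw [← h, ← pow_mul, pow_succ'])
      refine ⟨ε.symm l', ?_⟩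
      apply frobenius_inj (PerfLaurent F p) p
      rw [frobenius_def, frobenius_def, hl', Function.iterate_succ_apply,
        ← iterate_map_pow T, h1, ε.apply_symm_apply]
  have hT' : ∀ x, ∃ n l', x = T^[n] (PerfectClosure.of (LaurentSeries F) p l') := by
    intro x
    obtain ⟨n, l, h⟩ := perf_pow x
    exact ⟨n, hT n x l h⟩
  have all : ∀ l, PerfectClosure.of (LaurentSeries F) p l ∈ Subfield.closure X := by
    obtain ⟨x, hxX, hx⟩ := Set.not_subset.1 hX
    obtain ⟨n, l, rfl⟩ := hT' x
    have hl : PerfectClosure.of (LaurentSeries F) p l ∈ X := by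
      clear hx
      induction n with
      | zero => exact hxX
      | succ n ih =>
        apply ih
        have := hinv _ good' _ hxX
        rwa [Function.iterate_succ_apply', T.symm_apply_apply] at this
    have hlF : ∀ c, PerfectClosure.of (LaurentSeries F) p l ≠ algebraMap F (PerfLaurent F p) c := by
      intro c hc
      apply hx
      refine ⟨c, ?_⟩
      rw [hc]
      exact (Function.iterate_fixed (good.1 c) n).symm
    have nonconst : ∀ f : PowerSeries F, (∀ c, f ≠ PowerSeries.C c) →
        ∃ n, n ≠ 0 ∧ PowerSeries.coeff n f ≠ 0 := by
      intro f hf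
      by_contra! h
      apply hf (PowerSeries.coeff 0 f)
      ext n
      rw [PowerSeries.coeff_C]
      split_ifs with h'
      · rw [h']
      · exact h n h'
    obtain ⟨a, ha | ha⟩ : ∃ a : PowerSeries F, (a : LaurentSeries F) = l ∨ (a : LaurentSeries F) = l⁻¹ := by
      rcases ValuationRing.isInteger_or_isInteger (PowerSeries F) l with ⟨a, ha⟩ | ⟨a, ha⟩
      · exact ⟨a, Or.inl ha⟩
      · exact ⟨a, Or.inr ha⟩
    · subst ha
      obtain ⟨m, hm, hc⟩ := nonconst a (fun c hc => hlF c (by rw [algMap_eq, hc]))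
      exact main_descent X hinv m a hm hc hl
    · obtain ⟨m, hm, hc⟩ := nonconst a (fun c hc => hlF c⁻¹ (by
        rw [map_inv₀, algMap_eq, ← hc, ha, map_inv₀, inv_inv]))
      have := main_descent {x | x⁻¹ ∈ X} (fun τ hτ x hx => by
        have := hinv τ hτ _ hx
        rwa [map_inv₀] at this) m a hm hc (by
        change _⁻¹ ∈ X
        rw [ha, map_inv₀, inv_inv]; exact hl)
      intro l
      refine (Subfield.closure_le.2 ?_ : Subfield.closure {x | x⁻¹ ∈ X} ≤ _) (this l)
      intro x hx
      have := (Subfield.closure X).inv_mem (Subfield.subset_closure hx)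
      rwa [inv_inv] at this
  rw [eq_top_iff]
  rintro x -
  obtain ⟨n, l, rfl⟩ := hT' x
  have hTK : ∀ y ∈ Subfield.closure X, T y ∈ Subfield.closure X := by
    have : Subfield.closure X ≤ (Subfield.closure X).comap T.toRingHom := by
      rw [Subfield.closure_le]
      intro y hy
      exact Subfield.subset_closure (hinv T good y hy)
    exact fun y hy => this hy
  induction n with
  | zero => exact all l
  | succ n ih => rw [Function.iterate_succ_apply']; exact hTK _ ih

end Perf

/-- let `F` be perfect of characteristic `p > 0` and let
`X ⊆ F((t))^perf` be `∅`-definable over `F` in the valued field language on the perfect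
hull. If `X ⊄ F` then the subfield generated by `X` is all of `F((t))^perf`. -/
theorem statement18 [PerfectRing F p] (X : Set (PerfLaurent F p))
    (hdef : ∃ φ : (Lvf F).Formula (Fin 1),
      X = {x : PerfLaurent F p | φ.Realize (fun _ => x)})
    (hX : ¬ X ⊆ Set.range (algebraMap F (PerfLaurent F p))) :
    Subfield.closure X = ⊤ := by
  obtain ⟨φ, rfl⟩ := hdef
  exact main_closure _ (fun τ hτ x hx => goodAut_realize τ hτ φ x hx) hX
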